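/- Let 0<δ<1. For every ε>0 there exists x>0 such that for every C¹ function h on [0,∞) with ‖h'‖_{L^{∞,2-δ}_r} < x, the function f̃(r) = (1/r)∫₀ʳ (1-3s²) f(s) ds, where f(s)=exp((1/2)∫₀ˢ (h(ρ)-h̄(ρ))²/ρ dρ), satisfies 1-(1+ε)r² ≤ f̃(r) ≤ 1+ε-r² for all r≥0. -/

import Mathlib

open Set MeasureTheory Real

/-- Radial average: `w̄(r) = (1/r)∫₀ʳ w(s) ds` for `r ≠ 0`, with `w̄(0) = w(0)`. -/
noncomputable def radAvg (w : ℝ → ℝ) (r : ℝ) : ℝ :=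
  if r = 0 then w 0 else (∫ s in (0:ℝ)..r, w s) / r
/-- The metric coefficient `f(r) = exp((1/2)∫₀ʳ (h(s)-h̄(s))²/s ds)` built from `h`. -/
noncomputable def metF1 (h : ℝ → ℝ) (r : ℝ) : ℝ :=
  Real.exp (2⁻¹ * ∫ s in (0:ℝ)..r, (h s - radAvg h s) ^ 2 / s)
/-- The metric coefficient `f̃(r) = (1/r)∫₀ʳ (1-3s²) f(s) ds` (with value `1` at `r=0`). -/
noncomputable def metFt1 (h : ℝ → ℝ) (r : ℝ) : ℝ :=
  if r = 0 then 1 else (∫ s in (0:ℝ)..r, (1 - 3 * s ^ 2) * metF1 h s) / r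

lemma abs_mul_sub_integral_le {δ x : ℝ} (hδ₁ : 0 < δ) (hδ₂ : δ < 1) {h : ℝ → ℝ} (hh : ContDiff ℝ 1 h)
    (hx : ∀ s : ℝ, 0 ≤ s → (1 + s) ^ (2 - δ) * |deriv h s| ≤ x) {r : ℝ} (hr : 0 ≤ r) :
    |r * h r - ∫ s in (0:ℝ)..r, h s| ≤ x / δ * (r ^ 2 * (1 + r) ^ (δ - 2)) := by
  have hx0 : 0 ≤ x := le_trans (by positivity) (hx 0 le_rfl)
  have hG : ∀ s : ℝ, HasDerivAt (fun s => s * h s - ∫ t in (0:ℝ)..s, h t) (s * deriv h s) s := by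
    intro s
    have h1 : HasDerivAt h (deriv h s) s :=
      ((hh.differentiable one_ne_zero) s).hasDerivAt
    have h2 : HasDerivAt (fun s => ∫ t in (0:ℝ)..s, h t) (h s) s :=
      (hh.continuous.integral_hasStrictDerivAt 0 s).hasDerivAt
    exact (((hasDerivAt_id' s).mul h1).sub h2).congr_deriv (by ring)
  have hB : ∀ s : ℝ, 0 ≤ s → HasDerivAt (fun s => x / δ * (s ^ 2 * (1 + s) ^ (δ - 2)))
      (x / δ * (2 * s * (1 + s) ^ (δ - 2) + s ^ 2 * ((δ - 2) * (1 + s) ^ (δ - 2 - 1)))) s := by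
    intro s hs
    have h1 : HasDerivAt (fun s : ℝ => 1 + s) 1 s := (hasDerivAt_id' s).const_add 1
    have h2 := h1.rpow_const (p := δ - 2) (Or.inl (by positivity))
    exact (((hasDerivAt_pow 2 s).mul h2).const_mul (x / δ)).congr_deriv (by push_cast; ring)
  have key := image_norm_le_of_norm_deriv_right_le_deriv_boundary'
    (f := fun s => s * h s - ∫ t in (0:ℝ)..s, h t) (f' := fun s => s * deriv h s)
    (a := 0) (b := r)
    (fun s _ => (hG s).continuousAt.continuousWithinAt)
    (fun s _ => (hG s).hasDerivWithinAt)
    (B := fun s => x / δ * (s ^ 2 * (1 + s) ^ (δ - 2)))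
    (by simp)
    (fun s hs => (hB s hs.1).continuousAt.continuousWithinAt)
    (fun s hs => (hB s hs.1).hasDerivWithinAt)
    (by
      intro s hs
      have hs0 : 0 ≤ s := hs.1
      have h1s : 0 < 1 + s := by linarith
      have hd : |deriv h s| ≤ x * (1 + s) ^ (δ - 2) := by
        have := hx s hs0
        rw [show δ - 2 = -(2 - δ) by ring, rpow_neg h1s.le, ← div_eq_mul_inv,
          le_div_iff₀ (by positivity)]
        linarith
      rw [norm_mul, norm_of_nonneg hs0, norm_eq_abs, rpow_sub_one h1s.ne']
      have hP : 0 ≤ (1 + s) ^ (δ - 2) := by positivity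
      refine (mul_le_mul_of_nonneg_left hd hs0).trans ?_
      have : x / δ * (2 * s * (1 + s) ^ (δ - 2) + s ^ 2 * ((δ - 2) * ((1 + s) ^ (δ - 2) / (1 + s))))
          = s * (x * (1 + s) ^ (δ - 2)) + (2 - δ) * (x * s * (1 + s) ^ (δ - 2)) / (δ * (1 + s)) := by
        field_simp
        ring
      rw [this]
      have : 0 ≤ 2 - δ := by linarith
      have : 0 ≤ (2 - δ) * (x * s * (1 + s) ^ (δ - 2)) / (δ * (1 + s)) := by positivity
      linarith)
  exact key ⟨hr, le_rfl⟩

lemma sq_sub_radAvg_div_le {δ x : ℝ} (hδ₁ : 0 < δ) (hδ₂ : δ < 1) {h : ℝ → ℝ} (hh : ContDiff ℝ 1 h)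
    (hx : ∀ s : ℝ, 0 ≤ s → (1 + s) ^ (2 - δ) * |deriv h s| ≤ x) {s : ℝ} (hs : 0 < s) :
    (h s - radAvg h s) ^ 2 / s ≤ (x / δ) ^ 2 * (1 + s) ^ (2 * δ - 3) := by
  have hx0 : 0 ≤ x := le_trans (by positivity) (hx 0 le_rfl)
  have h1s : 0 < 1 + s := by linarith
  have hD : |h s - radAvg h s| ≤ x / δ * (s * (1 + s) ^ (δ - 2)) := by
    have := abs_mul_sub_integral_le hδ₁ hδ₂ hh hx hs.le
    have e : s * h s - ∫ t in (0:ℝ)..s, h t = s * (h s - radAvg h s) := by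
      simp only [radAvg, hs.ne', if_false]
      field_simp
    rw [e, abs_mul, abs_of_pos hs] at this
    refine le_of_mul_le_mul_left (this.trans_eq (by ring)) hs
  have hsq : (h s - radAvg h s) ^ 2 ≤ (x / δ * (s * (1 + s) ^ (δ - 2))) ^ 2 := by
    rw [← sq_abs]
    gcongr
  have hpow : ((1 + s) ^ (δ - 2)) ^ 2 * (1 + s) = (1 + s) ^ (2 * δ - 3) := by
    rw [← rpow_natCast, ← rpow_mul h1s.le, ← rpow_add_one h1s.ne']
    congr 1
    push_cast
    ring
  rw [div_le_iff₀ hs]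
  refine hsq.trans ?_
  rw [← hpow]
  have hP : 0 ≤ (x / δ) ^ 2 * ((1 + s) ^ (δ - 2)) ^ 2 * s := by positivity
  nlinarith

lemma intervalIntegrable_one_add_rpow (p : ℝ) {r : ℝ} (hr : 0 ≤ r) :
    IntervalIntegrable (fun s : ℝ => (1 + s) ^ p) volume 0 r := by
  refine ContinuousOn.intervalIntegrable fun s hs => ?_
  rw [uIcc_of_le hr] at hs
  have h1s : 1 + s ≠ 0 := by have := hs.1; positivity
  exact ((continuousAt_const.add continuousAt_id).rpow_const (Or.inl h1s)).continuousWithinAt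

lemma integral_one_add_rpow_le {q : ℝ} (hq : 0 < q) {r : ℝ} (hr : 0 ≤ r) :
    ∫ s in (0:ℝ)..r, (1 + s) ^ (-q - 1) ≤ 1 / q := by
  have hd : ∀ s ∈ uIcc 0 r, HasDerivAt (fun s : ℝ => -((1 + s) ^ (-q)) / q)
      ((1 + s) ^ (-q - 1)) s := by
    intro s hs
    rw [uIcc_of_le hr] at hs
    have h1 : HasDerivAt (fun s : ℝ => 1 + s) 1 s := (hasDerivAt_id' s).const_add 1
    have h2 := h1.rpow_const (p := -q) (Or.inl (by have := hs.1; positivity))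
    exact (h2.neg.div_const q).congr_deriv (by field_simp)
  rw [intervalIntegral.integral_eq_sub_of_hasDerivAt hd (intervalIntegrable_one_add_rpow _ hr)]
  have : 0 ≤ (1 + r) ^ (-q) / q := by positivity
  simp only [add_zero, one_rpow]
  rw [neg_div, neg_div]
  linarith

lemma integral_sq_sub_radAvg_div_le {δ x : ℝ} (hδ₁ : 0 < δ) (hδ₂ : δ < 1) {h : ℝ → ℝ}
    (hh : ContDiff ℝ 1 h)
    (hx : ∀ s : ℝ, 0 ≤ s → (1 + s) ^ (2 - δ) * |deriv h s| ≤ x) {r : ℝ} (hr : 0 ≤ r) :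
    ∫ s in (0:ℝ)..r, (h s - radAvg h s) ^ 2 / s ≤ (x / δ) ^ 2 * (1 / (2 - 2 * δ)) := by
  have hle := intervalIntegral.norm_integral_le_of_norm_le (μ := volume) hr
    (f := fun s => (h s - radAvg h s) ^ 2 / s)
    (g := fun s => (x / δ) ^ 2 * (1 + s) ^ (2 * δ - 3))
    (Filter.Eventually.of_forall fun s hs => by
      rw [norm_of_nonneg (div_nonneg (sq_nonneg _) hs.1.le)]
      exact sq_sub_radAvg_div_le hδ₁ hδ₂ hh hx hs.1)
    ((intervalIntegrable_one_add_rpow _ hr).const_mul _)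
  refine (le_abs_self _).trans (hle.trans ?_)
  rw [intervalIntegral.integral_const_mul]
  have := integral_one_add_rpow_le (q := 2 - 2 * δ) (by linarith) hr
  rw [show -(2 - 2 * δ) - 1 = 2 * δ - 3 by ring] at this
  gcongr

lemma intervalIntegrable_sq_sub_radAvg_div {δ x : ℝ} (hδ₁ : 0 < δ) (hδ₂ : δ < 1) {h : ℝ → ℝ}
    (hh : ContDiff ℝ 1 h)
    (hx : ∀ s : ℝ, 0 ≤ s → (1 + s) ^ (2 - δ) * |deriv h s| ≤ x) {r : ℝ} (hr : 0 ≤ r) :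
    IntervalIntegrable (fun s => (h s - radAvg h s) ^ 2 / s) volume 0 r := by
  refine ((intervalIntegrable_one_add_rpow (2 * δ - 3) hr).const_mul ((x / δ) ^ 2)).mono_fun ?_ ?_
  · rw [uIoc_of_le hr]
    have hc : ContinuousOn (fun s => (h s - (∫ t in (0:ℝ)..s, h t) / s) ^ 2 / s) (Ioc 0 r) := by
      have h0 : ∀ s ∈ Ioc 0 r, s ≠ 0 := fun s hs => hs.1.ne'
      have hI : Continuous fun s => ∫ t in (0:ℝ)..s, h t :=
        intervalIntegral.continuous_primitive (fun a b => hh.continuous.intervalIntegrable a b) 0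
      exact ((hh.continuous.continuousOn.sub
        (hI.continuousOn.div continuousOn_id h0)).pow 2).div continuousOn_id h0
    refine (hc.congr fun s hs => ?_).aestronglyMeasurable measurableSet_Ioc
    simp only [radAvg, hs.1.ne', if_false]
  · rw [uIoc_of_le hr]
    refine (ae_restrict_iff' measurableSet_Ioc).2 (Filter.Eventually.of_forall fun s hs => ?_)
    dsimp only
    rw [norm_of_nonneg (div_nonneg (sq_nonneg _) hs.1.le)]
    exact (sq_sub_radAvg_div_le hδ₁ hδ₂ hh hx hs.1).trans (le_abs_self _)

lemma one_le_metF1 (h : ℝ → ℝ) {r : ℝ} (hr : 0 ≤ r) : 1 ≤ metF1 h r := by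
  refine one_le_exp (mul_nonneg (by norm_num) ?_)
  exact intervalIntegral.integral_nonneg hr fun s hs => div_nonneg (sq_nonneg _) hs.1

/-- If `1 ≤ f ≤ 1 + ε` on `[0, r]`, then `f̃(r)` is within the corresponding bounds. -/
lemma metFt1_bounds {ε : ℝ} {h : ℝ → ℝ} {r : ℝ} (hr : 0 < r)
    (hc : ContinuousOn (metF1 h) (Icc 0 r))
    (hl : ∀ s ∈ Icc 0 r, 1 ≤ metF1 h s) (hu : ∀ s ∈ Icc 0 r, metF1 h s ≤ 1 + ε) :
    1 - (1 + ε) * r ^ 2 ≤ metFt1 h r ∧ metFt1 h r ≤ 1 + ε - r ^ 2 := by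
  have hint : IntervalIntegrable (fun s => (1 - 3 * s ^ 2) * metF1 h s) volume 0 r := by
    refine ContinuousOn.intervalIntegrable ?_
    rw [uIcc_of_le hr.le]
    exact (Continuous.continuousOn (by fun_prop)).mul hc
  have hpoly : ∀ a b : ℝ, ∫ s in (0:ℝ)..r, (a - b * (3 * s ^ 2)) = a * r - b * r ^ 3 := by
    intro a b
    rw [intervalIntegral.integral_eq_sub_of_hasDerivAt (f := fun s => a * s - b * s ^ 3)]
    · simp
    · intro s _
      exact (((hasDerivAt_id' s).const_mul a).sub ((hasDerivAt_pow 3 s).const_mul b)).congr_deriv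
        (by push_cast; ring)
    · exact Continuous.intervalIntegrable (by fun_prop) _ _
  simp only [metFt1, hr.ne', if_false]
  constructor
  · rw [le_div_iff₀ hr]
    have := intervalIntegral.integral_mono_on (μ := volume) hr.le
      (f := fun s => 1 - (1 + ε) * (3 * s ^ 2))
      (Continuous.intervalIntegrable (by fun_prop) _ _) hint
      (fun s hs => by nlinarith [hl s hs, mul_le_mul_of_nonneg_left (hu s hs) (sq_nonneg s)])
    rw [hpoly] at this
    linarith
  · rw [div_le_iff₀ hr]
    have := intervalIntegral.integral_mono_on (μ := volume) hr.le
      (g := fun s => (1 + ε) - 1 * (3 * s ^ 2)) hint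
      (Continuous.intervalIntegrable (by fun_prop) _ _)
      (fun s hs => by nlinarith [hu s hs, mul_le_mul_of_nonneg_left (hl s hs) (sq_nonneg s)])
    rw [hpoly] at this
    linarith

theorem ftilde_bounds (δ : ℝ) (hδ₁ : 0 < δ) (hδ₂ : δ < 1) (ε : ℝ) (hε : 0 < ε) :
    ∃ x > (0:ℝ), ∀ h : ℝ → ℝ, ContDiff ℝ 1 h →
      (∀ s : ℝ, 0 ≤ s → (1 + s) ^ (2 - δ) * |deriv h s| ≤ x) →
      ∀ r : ℝ, 0 ≤ r →
        1 - (1 + ε) * r ^ 2 ≤ metFt1 h r ∧ metFt1 h r ≤ 1 + ε - r ^ 2 := by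
  have hlog : 0 < log (1 + ε) := log_pos (by linarith)
  have hq : 0 < 2 - 2 * δ := by linarith
  refine ⟨δ * √(2 * (2 - 2 * δ) * log (1 + ε)), by positivity, fun h hh hx r hr => ?_⟩
  rcases hr.eq_or_lt with rfl | hr
  · simp [metFt1, hε.le]
  refine metFt1_bounds hr ?_ (fun s hs => one_le_metF1 h hs.1) fun s hs => ?_
  · have := intervalIntegral.continuousOn_primitive_interval'
      (intervalIntegrable_sq_sub_radAvg_div hδ₁ hδ₂ hh hx hr.le) left_mem_uIcc
    rw [uIcc_of_le hr.le] at this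
    exact (continuousOn_const.mul this).rexp
  · have := integral_sq_sub_radAvg_div_le hδ₁ hδ₂ hh hx hs.1
    rw [mul_div_cancel_left₀ _ hδ₁.ne', sq_sqrt (by positivity)] at this
    rw [metF1, ← le_log_iff_exp_le (by positivity)]
    have e : 2 * (2 - 2 * δ) * log (1 + ε) * (1 / (2 - 2 * δ)) = 2 * log (1 + ε) := by
      rw [mul_one_div, mul_right_comm, mul_div_cancel_right₀ _ hq.ne']
    linarith
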